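/- Let S be a finite type of states with a successor relation succ, an initial state s0 and a goal predicate, and suppose s0 is solvable. Then the perfect heuristic h* : S → ℕ∞ is direct: every state in S↓ (defined with respect to h*) has a successor s' with h*(s') < h*(s), and every such improving successor of a state in S↓ is either a goal state or belongs to S↓. (Every solvable task admits a direct heuristic, namely the perfect heuristic.) -/

import Mathlib

/-- A state `s` is reachable from `s0` via the successor relation. -/
def Reachable {S : Type*} (succ : S → S → Prop) (s0 s : S) : Prop :=
  Relation.ReflTransGen succ s0 s

/-- A state `s` is solvable: some goal state is reachable from it. -/
def Solvable {S : Type*} (succ : S → S → Prop) (goal : S → Prop) (s : S) : Prop :=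
  ∃ g, goal g ∧ Relation.ReflTransGen succ s g

/-- A state is alive if it is reachable, solvable, and not a goal. -/
def Alive {S : Type*} (succ : S → S → Prop) (s0 : S) (goal : S → Prop) (s : S) : Prop :=
  Reachable succ s0 s ∧ Solvable succ goal s ∧ ¬ goal s

/-- `StepsTo succ n s t`: there is a sequence of exactly `n` `succ`-steps from `s` to `t`. -/
inductive StepsTo {S : Type*} (succ : S → S → Prop) : ℕ → S → S → Prop
  | refl (s : S) : StepsTo succ 0 s s
  | tail {n : ℕ} {s t u : S} : StepsTo succ n s t → succ t u → StepsTo succ (n + 1) s u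

/-- The perfect heuristic `h*`: the minimal number of `succ`-steps needed to reach a goal
state, and `⊤` if no goal state is reachable. -/
noncomputable def hStar {S : Type*} (succ : S → S → Prop) (goal : S → Prop) (s : S) : ℕ∞ :=
  sInf {n : ℕ∞ | ∃ m : ℕ, n = (m : ℕ∞) ∧ ∃ g, goal g ∧ StepsTo succ m s g}

/-- An improving step with respect to an `ℕ∞`-valued heuristic. -/
def Improving {S : Type*} (succ : S → S → Prop) (h : S → ℕ∞) (s s' : S) : Prop :=
  succ s s' ∧ h s' < h s

/-- `S↓`: the set of alive states reachable from `s0` via improving steps. -/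
def SDown {S : Type*} (succ : S → S → Prop) (s0 : S) (goal : S → Prop) (h : S → ℕ∞) : Set S :=
  {s | Alive succ s0 goal s ∧ Relation.ReflTransGen (Improving succ h) s0 s}

theorem StepsTo.toRefl {S : Type*} {succ : S → S → Prop} {n : ℕ} {s t : S}
    (h : StepsTo succ n s t) : Relation.ReflTransGen succ s t := by
  induction h with
  | refl s => exact Relation.ReflTransGen.refl
  | tail _ h2 ih => exact ih.tail h2

theorem StepsTo.ofRefl {S : Type*} {succ : S → S → Prop} {s t : S}
    (h : Relation.ReflTransGen succ s t) : ∃ n, StepsTo succ n s t := by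
  induction h with
  | refl => exact ⟨0, StepsTo.refl s⟩
  | tail _ h2 ih =>
    obtain ⟨n, hn⟩ := ih
    exact ⟨n + 1, hn.tail h2⟩

theorem StepsTo.head_cases {S : Type*} {succ : S → S → Prop} {n : ℕ} {s t : S}
    (h : StepsTo succ n s t) :
    (n = 0 ∧ s = t) ∨ ∃ m u, n = m + 1 ∧ succ s u ∧ StepsTo succ m u t := by
  induction h with
  | refl s => exact Or.inl ⟨rfl, rfl⟩
  | @tail n s t u _ h2 ih =>
    right
    rcases ih with ⟨rfl, rfl⟩ | ⟨m, v, rfl, hv, hm⟩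
    · exact ⟨0, u, rfl, h2, StepsTo.refl u⟩
    · exact ⟨m + 1, v, rfl, hv, hm.tail h2⟩

theorem hStar_attained {S : Type*} {succ : S → S → Prop} {goal : S → Prop} {s : S}
    (h : Solvable succ goal s) :
    ∃ m : ℕ, hStar succ goal s = (m : ℕ∞) ∧ ∃ g, goal g ∧ StepsTo succ m s g := by
  obtain ⟨g, hg, hr⟩ := h
  obtain ⟨n, hn⟩ := StepsTo.ofRefl hr
  exact csInf_mem
    (s := {n : ℕ∞ | ∃ m : ℕ, n = (m : ℕ∞) ∧ ∃ g, goal g ∧ StepsTo succ m s g})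
    ⟨(n : ℕ∞), n, rfl, g, hg, hn⟩

theorem solvable_of_hStar_lt {S : Type*} {succ : S → S → Prop} {goal : S → Prop} {s : S}
    {b : ℕ∞} (h : hStar succ goal s < b) : Solvable succ goal s := by
  obtain ⟨_, ⟨m, _, g, hg, hm⟩, _⟩ := sInf_lt_iff.mp h
  exact ⟨g, hg, hm.toRefl⟩

/-- If the initial state is solvable, then the perfect heuristic is direct: every state of
`S↓` has an improving successor, and every improving successor of a state in `S↓` is a goal
state or belongs to `S↓`. -/
theorem hStar_direct {S : Type*} [Fintype S]
    (succ : S → S → Prop) (s0 : S) (goal : S → Prop)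
    (hsolv : Solvable succ goal s0) :
    (∀ s ∈ SDown succ s0 goal (hStar succ goal),
        ∃ s', succ s s' ∧ hStar succ goal s' < hStar succ goal s) ∧
    (∀ s ∈ SDown succ s0 goal (hStar succ goal), ∀ s',
        succ s s' → hStar succ goal s' < hStar succ goal s →
        goal s' ∨ s' ∈ SDown succ s0 goal (hStar succ goal)) := by
  constructor
  · rintro s ⟨⟨_, hs, hng⟩, _⟩
    obtain ⟨m, hm, g, hg, hst⟩ := hStar_attained hs
    rcases hst.head_cases with ⟨_, rfl⟩ | ⟨k, u, rfl, hu, hk⟩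
    · exact absurd hg hng
    · refine ⟨u, hu, ?_⟩
      rw [hm]
      have h1 : hStar succ goal u ≤ (k : ℕ∞) := sInf_le ⟨k, rfl, g, hg, hk⟩
      exact lt_of_le_of_lt h1 (by exact_mod_cast Nat.lt_succ_self k)
  · rintro s ⟨⟨hr, _, _⟩, hd⟩ s' hss hlt
    by_cases hg : goal s'
    · exact Or.inl hg
    · exact Or.inr ⟨⟨Relation.ReflTransGen.tail hr hss, solvable_of_hStar_lt hlt, hg⟩,
        hd.tail ⟨hss, hlt⟩⟩
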